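/- Let k be a positive integer and let G be a graph with n ≥ 5 nodes and vector-valued edge weights g_{i,j} ∈ ℝ^k (and no node weights). Suppose that g_{i,j} + g_{j,k} ≠ g_{m,p} + g_{q,r} (as vectors in ℝ^k) for every pairwise distinct i, j, k ∈ {1,…,n} and every pairwise distinct m, p, q, r ∈ {1,…,n}. Then G is reconstructible from D_g(G) and D_α(G): every graph G' with n nodes and edge weights in ℝ^k such that D_g(G') = D_g(G) and D_α(G') = D_α(G) is isomorphic to G. -/

import Mathlib

/-- The multiset of edge weights `g{i,j}` over unordered pairs `{i,j}`, `i ≠ j`. -/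
def edgeDist {n : ℕ} {X : Type*} (g : Sym2 (Fin n) → X) : Multiset X :=
  ((Finset.univ : Finset (Fin n × Fin n)).filter (fun p => p.1 < p.2)).val.map
    (fun p => g s(p.1, p.2))

/-- The multiset of sums of adjacent edge weights
`α_{i,j,k} = g{i,j} + g{j,k}` over triples of pairwise distinct `i, j, k`. -/
def adjDist {n : ℕ} {X : Type*} [Add X] (g : Sym2 (Fin n) → X) : Multiset X :=
  ((Finset.univ : Finset (Fin n × Fin n × Fin n)).filter
      (fun p => p.1 ≠ p.2.1 ∧ p.2.1 ≠ p.2.2 ∧ p.1 ≠ p.2.2)).val.map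
    (fun p => g s(p.1, p.2.1) + g s(p.2.1, p.2.2))

/-- Two graphs with edge weights and no node weights are isomorphic if there is
a permutation `π` of the nodes with `g'{i,j} = g{π i, π j}` for all `i ≠ j`. -/
def EdgeGraphIso {n : ℕ} {X : Type*} (g g' : Sym2 (Fin n) → X) : Prop :=
  ∃ π : Equiv.Perm (Fin n), ∀ i j : Fin n, i ≠ j → g' s(i, j) = g s(π i, π j)

/-- Two functions on a finite type with the same multiset of values differ by a permutation. -/
theorem exists_perm_of_map_univ_eq {α β : Type*} [Fintype α] (f g : α → β)
    (h : (Finset.univ : Finset α).val.map f = (Finset.univ : Finset α).val.map g) :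
    ∃ σ : Equiv.Perm α, ∀ a, f a = g (σ a) := by
  classical
  have hcard : ∀ y, Fintype.card {a // f a = y} = Fintype.card {a // g a = y} := fun y => by
    have hy := congrArg (Multiset.count y) h
    rw [Multiset.count_map, Multiset.count_map] at hy
    simp only [Fintype.card_subtype, eq_comm (b := y)]
    exact hy
  exact ⟨Equiv.ofFiberEquiv fun y => Fintype.equivOfCardEq (hcard y),
    fun a => (Equiv.ofFiberEquiv_map _ a).symm⟩

/-- The edge distribution is the multiset of weights of non-diagonal unordered pairs. -/
theorem edgeDist_eq_map_not_isDiag {n : ℕ} {X : Type*} (g : Sym2 (Fin n) → X) :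
    edgeDist g = (Finset.univ : Finset {e : Sym2 (Fin n) // ¬ e.IsDiag}).val.map
      (fun e => g e.1) := by
  symm
  unfold edgeDist
  refine Multiset.map_eq_map_of_bij_of_nodup _ _ (Finset.nodup _) (Finset.nodup _)
    (fun e _ => (e.1.inf, e.1.sup)) ?_ ?_ ?_ ?_
  · rintro ⟨e, he⟩ -
    induction e with
    | _ a b => simpa [eq_comm] using he
  · rintro ⟨e, he⟩ - ⟨f, hf⟩ - h
    simp only [Prod.mk.injEq] at h
    exact Subtype.ext (Sym2.inf_eq_inf_and_sup_eq_sup.mp h)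
  · rintro ⟨a, b⟩ hab
    have hlt : a < b := by simpa using hab
    exact ⟨⟨s(a, b), by simpa using hlt.ne⟩, Finset.mem_univ_val _, by simp [hlt.le]⟩
  · rintro ⟨e, he⟩ -
    induction e with
    | _ a b =>
      rcases le_total a b with h | h
      · simp [h]
      · simp [h, Sym2.eq_swap]

/-- An injective family of edges, indexed by the nodes other than `i`, whose members
pairwise meet has a common node when there are at least five nodes. -/
theorem exists_common_node {n : ℕ} {V : Type*} (hn : 5 ≤ n) (i : Fin n)
    (F : Fin n → Sym2 V)
    (hinj : ∀ a b, a ≠ i → b ≠ i → a ≠ b → F a ≠ F b)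
    (hmeet : ∀ a b, a ≠ i → b ≠ i → a ≠ b → ∃ v, v ∈ F a ∧ v ∈ F b) :
    ∃ v, ∀ a, a ≠ i → v ∈ F a := by
  classical
  have avoid : ∀ s : Finset (Fin n), s.card < 5 → ∃ d, d ∉ s := fun s hs => by
    by_contra! h
    have := Finset.card_le_card (fun x _ => h x : Finset.univ ⊆ s)
    simp at this
    omega
  obtain ⟨a, ha⟩ := avoid {i} (by simp)
  obtain ⟨b, hb⟩ := avoid {i, a} (lt_of_le_of_lt Finset.card_le_two (by norm_num))
  simp only [Finset.mem_insert, Finset.mem_singleton, not_or] at ha hb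
  obtain ⟨v, hva, hvb⟩ := hmeet a b ha hb.1 (Ne.symm hb.2)
  obtain ⟨x, hx⟩ := hva
  obtain ⟨y, hy⟩ := hvb
  have hab := hinj a b ha hb.1 (Ne.symm hb.2)
  refine ⟨v, fun c hc => ?_⟩
  by_contra hvc
  have hca : c ≠ a := by rintro rfl; exact hvc (by simp [hx])
  have hcb : c ≠ b := by rintro rfl; exact hvc (by simp [hy])
  obtain ⟨d, hd⟩ := avoid {i, a, b, c} (lt_of_le_of_lt Finset.card_le_four (by norm_num))
  simp only [Finset.mem_insert, Finset.mem_singleton, not_or] at hd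
  obtain ⟨hdi, hda, hdb, hdc⟩ := hd
  have h1 := hmeet c a hc ha hca
  have h2 := hmeet c b hc hb.1 hcb
  have h3 := hmeet d a hdi ha hda
  have h4 := hmeet d b hdi hb.1 hdb
  have h5 := hmeet d c hdi hc hdc
  have h6 := hinj d a hdi ha hda
  have h7 := hinj d b hdi hb.1 hdb
  have h8 := hinj d c hdi hc hdc
  rw [hx] at *
  rw [hy] at *
  generalize F c = C at *
  generalize F d = D at *
  induction C with
  | _ c₁ c₂ =>
  induction D with
  | _ d₁ d₂ =>
  simp only [Sym2.mem_iff, ne_eq, Sym2.eq_iff] at *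
  grind

/-- An injective self-map of the edges of a complete graph on at least five nodes that
preserves adjacency is induced by a permutation of the nodes. -/
theorem exists_perm_of_adjacent_preserving {n : ℕ} (hn : 5 ≤ n) (φ : Sym2 (Fin n) → Sym2 (Fin n))
    (hdiag : ∀ e, ¬ e.IsDiag → ¬ (φ e).IsDiag)
    (hinj : ∀ e f, ¬ e.IsDiag → ¬ f.IsDiag → φ e = φ f → e = f)
    (hadj : ∀ i j l : Fin n, i ≠ j → j ≠ l → i ≠ l → ∃ v, v ∈ φ s(i, j) ∧ v ∈ φ s(j, l)) :
    ∃ π : Equiv.Perm (Fin n), ∀ i j, i ≠ j → φ s(i, j) = s(π i, π j) := by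
  classical
  have hstar : ∀ i, ∃ v, ∀ j, j ≠ i → v ∈ φ s(i, j) := fun i =>
    exists_common_node hn i (fun j => φ s(i, j))
      (fun a b ha hb hab h => hab (by
        have := hinj _ _ (by simpa using ha.symm) (by simpa using hb.symm) h
        simp only [Sym2.eq_iff] at this
        grind))
      (fun a b ha hb hab => by
        rw [Sym2.eq_swap]
        exact hadj a i b ha hb.symm hab)
  choose π hπ using hstar
  have hπinj : Function.Injective π := by
    intro i j hij
    by_contra hne
    have hother : ∀ x : {x // x ≠ i}, ∃ y, φ s(i, x.1) = s(π i, y) := fun x => hπ i x.1 x.2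
    choose f hf using hother
    have hfne : ∀ x, f x ≠ π i := fun x h => by
      have := hdiag s(i, x.1) (by simpa using x.2.symm)
      rw [hf x, h] at this
      simp at this
    let f' : {x // x ≠ i} → {y // y ≠ π i} := fun x => ⟨f x, hfne x⟩
    have hf'inj : Function.Injective f' := by
      intro x y hxy
      have hxy' : f x = f y := congrArg Subtype.val hxy
      have := hinj s(i, x.1) s(i, y.1) (by simpa using x.2.symm) (by simpa using y.2.symm)
        (by rw [hf, hf, hxy'])
      simp only [Sym2.eq_iff] at this
      exact Subtype.ext (by grind)
    have hf'surj : Function.Surjective f' :=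
      ((Fintype.bijective_iff_injective_and_card f').mpr ⟨hf'inj, by simp⟩).2
    obtain ⟨l, hl⟩ : ∃ l, l ∉ ({i, j} : Finset (Fin n)) := by
      by_contra! h
      have h₁ := Finset.card_le_card (fun x _ => h x : Finset.univ ⊆ ({i, j} : Finset (Fin n)))
      have h₂ : ({i, j} : Finset (Fin n)).card ≤ 2 := Finset.card_le_two
      simp only [Finset.card_univ, Fintype.card_fin] at h₁
      omega
    simp only [Finset.mem_insert, Finset.mem_singleton, not_or] at hl
    obtain ⟨y, hy⟩ := hπ j l hl.2
    have hjl : ¬ (s(j, l) : Sym2 (Fin n)).IsDiag := by simpa using Ne.symm hl.2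
    have hyne : y ≠ π i := fun h => by
      have := hdiag _ hjl
      rw [hy, h, hij] at this
      simp at this
    obtain ⟨x, hx⟩ := hf'surj ⟨y, hyne⟩
    have hxy : f x = y := congrArg Subtype.val hx
    have := hinj s(i, x.1) s(j, l) (by simpa using x.2.symm) hjl (by rw [hf, hy, hxy, hij])
    simp only [Sym2.eq_iff] at this
    grind
  refine ⟨Equiv.ofBijective π (Finite.injective_iff_bijective.mp hπinj), fun i j hij => ?_⟩
  have hi := hπ i j hij.symm
  have hj := hπ j i hij
  rw [Sym2.eq_swap] at hj
  exact (Sym2.mem_and_mem_iff (hπinj.ne hij)).mp ⟨hi, hj⟩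

/-- A graph with `n ≥ 5` nodes and vector-valued edge weights in `ℝ^k` such
that no sum of weights of two adjacent edges equals a sum of weights of two
non-adjacent edges is reconstructible from the distribution of its edge
weights together with the distribution of sums of adjacent edge weights. -/
theorem reconstructible_of_edgeDist_adjDist_vector {n k : ℕ} (hn : 5 ≤ n)
    (hk : 0 < k) (g : Sym2 (Fin n) → (Fin k → ℝ))
    (hyp : ∀ i j l m p q r : Fin n,
      i ≠ j → j ≠ l → i ≠ l →
      m ≠ p → m ≠ q → m ≠ r → p ≠ q → p ≠ r → q ≠ r →
      g s(i, j) + g s(j, l) ≠ g s(m, p) + g s(q, r)) :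
    ∀ g' : Sym2 (Fin n) → (Fin k → ℝ), edgeDist g' = edgeDist g →
      adjDist g' = adjDist g → EdgeGraphIso g g' := by
  intro g' hedge hadj
  rw [edgeDist_eq_map_not_isDiag, edgeDist_eq_map_not_isDiag] at hedge
  obtain ⟨σ, hσ⟩ := exists_perm_of_map_univ_eq _ _ hedge
  have hσ' : ∀ e (he : ¬ e.IsDiag), g' e = g (σ ⟨e, he⟩).1 := fun e he => hσ ⟨e, he⟩
  classical
  let φ : Sym2 (Fin n) → Sym2 (Fin n) := fun e =>
    if he : e.IsDiag then e else (σ ⟨e, he⟩).1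
  have hφ : ∀ e (he : ¬ e.IsDiag), φ e = (σ ⟨e, he⟩).1 := fun e he => dif_neg he
  have hφinj : ∀ e f, ¬ e.IsDiag → ¬ f.IsDiag → φ e = φ f → e = f := fun e f he hf h => by
    rw [hφ e he, hφ f hf] at h
    exact congrArg Subtype.val (σ.injective (Subtype.ext h))
  have hφdiag : ∀ e, ¬ e.IsDiag → ¬ (φ e).IsDiag := fun e he => by
    rw [hφ e he]
    exact (σ ⟨e, he⟩).2
  have hgφ : ∀ e, ¬ e.IsDiag → g' e = g (φ e) := fun e he => by rw [hφ e he, hσ' e he]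
  obtain ⟨π, hπ⟩ := exists_perm_of_adjacent_preserving hn φ hφdiag hφinj (by
    intro i j l hij hjl hil
    have hmem : g' s(i, j) + g' s(j, l) ∈ adjDist g := by
      rw [← hadj]
      exact Multiset.mem_map.mpr ⟨(i, j, l), by simp [hij, hjl, hil], rfl⟩
    obtain ⟨⟨a, b, c⟩, habc, hsum⟩ := Multiset.mem_map.mp hmem
    simp only [Finset.mem_val, Finset.mem_filter, Finset.mem_univ, true_and] at habc hsum
    have hij' : ¬ (s(i, j) : Sym2 (Fin n)).IsDiag := by simpa using hij
    have hjl' : ¬ (s(j, l) : Sym2 (Fin n)).IsDiag := by simpa using hjl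
    rw [hgφ _ hij', hgφ _ hjl'] at hsum
    have hd₁ := hφdiag _ hij'
    have hd₂ := hφdiag _ hjl'
    by_contra! hdisj
    generalize φ s(i, j) = e at *
    generalize φ s(j, l) = f at *
    induction e with
    | _ m p =>
    induction f with
    | _ q r =>
    simp only [Sym2.mem_iff, Sym2.mk_isDiag_iff] at hdisj hd₁ hd₂
    exact hyp a b c m p q r habc.1 habc.2.1 habc.2.2 hd₁ (by grind) (by grind) (by grind)
      (by grind) hd₂ hsum)
  exact ⟨π, fun i j hij => by rw [hgφ _ (by simpa using hij), hπ i j hij]⟩
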